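/- Let ([n],{Π_s}) be a satisfiable instance of quantum k-SAT and let x₁ ∈ [n] be any qubit. Then there is at most one qubit x₂ ∈ [n]∖{x₁} such that the instance is not locally satisfiable by a product state at {x₁,x₂}. Equivalently, for any state |ψ⟩ ∈ (ℂ²)^{⊗n} and any x₁ ∈ [n], there is at most one x₂ ∈ [n]∖{x₁} such that the subspace supp(Tr_{\overline{\{x₁,x₂\}}}(|ψ⟩⟨ψ|)) ⊆ ℂ²⊗ℂ² contains no nonzero product vector. -/

import Mathlib

open scoped Classical

namespace QkSAT

/-- The Hilbert space of the qubits indexed by the subset `C` of `[n]`,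
with basis indexed by bit strings on `C`. -/
abbrev QVec (n : ℕ) (C : Finset (Fin n)) : Type := (↥C → Fin 2) → ℂ

/-- Extend an operator acting on the qubits in `s` to an operator on the qubits of `C ⊇ s`
which acts trivially on the qubits outside `s`. -/
noncomputable def extendOp {n : ℕ} (s C : Finset (Fin n))
    (K : Matrix (↥s → Fin 2) (↥s → Fin 2) ℂ) :
    Matrix (↥C → Fin 2) (↥C → Fin 2) ℂ :=
  Matrix.of fun f g =>
    if hs : s ⊆ C then
      if ∀ i : ↥C, (i : Fin n) ∉ s → f i = g i then
        K (fun j => f ⟨j.1, hs j.2⟩) (fun j => g ⟨j.1, hs j.2⟩)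
      else 0
    else 0

/-- An instance of quantum `k`-SAT on `n` qubits: for every `k`-element subset `s` of the
qubits, an orthogonal projection acting nontrivially only on the qubits in `s`, specified by
its matrix on the qubits in `s`. -/
structure Instance (n k : ℕ) where
  K : (s : Finset (Fin n)) → Matrix (↥s → Fin 2) (↥s → Fin 2) ℂ
  isHermitian : ∀ s : Finset (Fin n), s.card = k → (K s).IsHermitian
  isIdempotent : ∀ s : Finset (Fin n), s.card = k → K s * K s = K s

/-- `∑_{s ∈ σ_k(C)} Π_s ψ` for a vector `ψ` on the qubits in `C`. -/
noncomputable def constraintSum {n k : ℕ} (I : Instance n k) (C : Finset (Fin n))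
    (ψ : QVec n C) : QVec n C :=
  ∑ s ∈ Finset.powersetCard k C, (extendOp s C (I.K s)).mulVec ψ

/-- The restriction of the instance to the qubits in `C` is satisfiable. -/
def SatisfiableAt {n k : ℕ} (I : Instance n k) (C : Finset (Fin n)) : Prop :=
  ∃ ψ : QVec n C, ψ ≠ 0 ∧ constraintSum I C ψ = 0

/-- The instance is satisfiable. -/
def Satisfiable {n k : ℕ} (I : Instance n k) : Prop :=
  SatisfiableAt I Finset.univ

/-- The product vector `⊗ᵢ φᵢ`. -/
def prodVec {ι : Type*} [Fintype ι] (φ : ι → (Fin 2 → ℂ)) : (ι → Fin 2) → ℂ :=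
  fun f => ∏ i, φ i (f i)

/-- The instance is locally satisfiable by a product state at `C`. -/
def ProdSatisfiableAt {n k : ℕ} (I : Instance n k) (C : Finset (Fin n)) : Prop :=
  ∃ φ : ↥C → (Fin 2 → ℂ), (∀ i, φ i ≠ 0) ∧ constraintSum I C (prodVec φ) = 0

/-- The instance is `ε`-far from satisfiable by a product state: whenever removing the
constraints indexed by `Sig` admits a (nonzero) product-state solution, `|Sig| ≥ ε n^k`. -/
def EpsFarFromProdSat {n k : ℕ} (I : Instance n k) (ε : ℝ) : Prop :=
  ∀ Sig : Finset (Finset (Fin n)),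
    (∃ φ : ↥(Finset.univ : Finset (Fin n)) → (Fin 2 → ℂ), (∀ i, φ i ≠ 0) ∧
      ∑ s ∈ Finset.powersetCard k (Finset.univ : Finset (Fin n)) \ Sig,
        (extendOp s Finset.univ (I.K s)).mulVec (prodVec φ) = 0) →
    ε * (n : ℝ) ^ k ≤ (Sig.card : ℝ)


/-- Combine a bit string on the qubits in `C` with a bit string on the qubits outside `C`
into a bit string on all `n` qubits. -/
def merge {n : ℕ} (C : Finset (Fin n)) (f : ↥C → Fin 2) (g : ↥Cᶜ → Fin 2) : Fin n → Fin 2 :=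
  fun i => if h : i ∈ C then f ⟨i, h⟩ else g ⟨i, Finset.mem_compl.mpr h⟩

/-- The support of the reduced density matrix of `ψ` on the qubits in `C` (tracing out the
qubits outside `C`): the span of the contractions of `ψ` against the basis vectors on the
qubits outside `C`, i.e. `span{(⟨v|⊗1_C)|ψ⟩ : v}`. -/
noncomputable def reducedSupp {n : ℕ} (C : Finset (Fin n)) (ψ : (Fin n → Fin 2) → ℂ) :
    Submodule ℂ (QVec n C) :=
  Submodule.span ℂ {w | ∃ g : ↥Cᶜ → Fin 2, w = fun f => ψ (merge C f g)}

/-- The subspace `W` of the Hilbert space of the qubits in `C` contains a nonzero product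
vector `|φ₁⟩⊗…⊗|φ_c⟩`. -/
def ContainsProdVec {n : ℕ} (C : Finset (Fin n)) (W : Submodule ℂ (QVec n C)) : Prop :=
  ∃ φ : ↥C → (Fin 2 → ℂ), (∀ i, φ i ≠ 0) ∧ prodVec φ ∈ W

end QkSAT

namespace QkSAT

/-- The bit string that agrees with `a` on `s` and with `f` elsewhere. -/
def override {n : ℕ} (s C : Finset (Fin n)) (f : ↥C → Fin 2) (a : ↥s → Fin 2) : ↥C → Fin 2 :=
  fun i => if h : (i : Fin n) ∈ s then a ⟨i, h⟩ else f i

lemma override_apply_mem {n : ℕ} {s C : Finset (Fin n)} (hs : s ⊆ C) (f : ↥C → Fin 2)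
    (a : ↥s → Fin 2) : (fun j : ↥s => override s C f a ⟨j.1, hs j.2⟩) = a := by
  ext j
  simp [override]

lemma override_override {n : ℕ} (s C : Finset (Fin n)) (f : ↥C → Fin 2) (a b : ↥s → Fin 2) :
    override s C (override s C f a) b = override s C f b := by
  ext i
  by_cases h : (i : Fin n) ∈ s <;> simp [override, h]

lemma extendOp_mulVec_apply {n : ℕ} {s C : Finset (Fin n)} (hs : s ⊆ C)
    (K : Matrix (↥s → Fin 2) (↥s → Fin 2) ℂ) (ψ : QVec n C) (f : ↥C → Fin 2) :
    (extendOp s C K).mulVec ψ f =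
      ∑ a, K (fun j => f ⟨j.1, hs j.2⟩) a * ψ (override s C f a) := by
  have hE : ∀ g, extendOp s C K f g * ψ g =
      if ∀ i : ↥C, (i : Fin n) ∉ s → f i = g i then
        K (fun j => f ⟨j.1, hs j.2⟩) (fun j => g ⟨j.1, hs j.2⟩) * ψ g else 0 := by
    intro g
    simp [extendOp, hs]
  rw [Matrix.mulVec, dotProduct]
  simp_rw [hE]
  rw [← Finset.sum_filter]
  symm
  refine Finset.sum_bij' (fun a _ => override s C f a) (fun g _ j => g ⟨j.1, hs j.2⟩)
    ?_ ?_ ?_ ?_ ?_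
  · intro a _
    rw [Finset.mem_filter]
    exact ⟨Finset.mem_univ _, fun i hi => by simp [override, hi]⟩
  · intro g _
    exact Finset.mem_univ _
  · intro a _
    exact override_apply_mem hs f a
  · intro g hg
    rw [Finset.mem_filter] at hg
    funext i
    by_cases h : (i : Fin n) ∈ s
    · simp [override, h]
    · simp [override, h, hg.2 i h]
  · intro a _
    rw [override_apply_mem hs f a]

lemma extendOp_isHermitian {n : ℕ} (s C : Finset (Fin n))
    {K : Matrix (↥s → Fin 2) (↥s → Fin 2) ℂ} (hK : K.IsHermitian) :
    (extendOp s C K).IsHermitian := by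
  refine Matrix.IsHermitian.ext fun f g => ?_
  by_cases hs : s ⊆ C
  · have hc : (∀ i : ↥C, (i : Fin n) ∉ s → g i = f i) ↔
        ∀ i : ↥C, (i : Fin n) ∉ s → f i = g i :=
      ⟨fun h i hi => (h i hi).symm, fun h i hi => (h i hi).symm⟩
    simp only [extendOp, Matrix.of_apply, hs, dite_true, hc]
    split_ifs
    · exact hK.apply _ _
    · exact star_zero _
  · simp [extendOp, hs]

lemma extendOp_mulVec_mulVec {n : ℕ} {s C : Finset (Fin n)} (hs : s ⊆ C)
    {K : Matrix (↥s → Fin 2) (↥s → Fin 2) ℂ} (hK : K * K = K) (ψ : QVec n C) :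
    (extendOp s C K).mulVec ((extendOp s C K).mulVec ψ) = (extendOp s C K).mulVec ψ := by
  funext f
  rw [extendOp_mulVec_apply hs, extendOp_mulVec_apply hs]
  simp_rw [extendOp_mulVec_apply hs K ψ, override_apply_mem, override_override, Finset.mul_sum]
  rw [Finset.sum_comm]
  refine Finset.sum_congr rfl fun b _ => ?_
  conv_rhs => rw [← hK, Matrix.mul_apply, Finset.sum_mul]
  exact Finset.sum_congr rfl fun a _ => (mul_assoc _ _ _).symm

open scoped ComplexOrder in
/-- A family of orthogonal projections whose sum annihilates `ψ` annihilates `ψ` termwise. -/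
lemma extendOp_mulVec_eq_zero {n k : ℕ} (I : Instance n k) {C : Finset (Fin n)} {ψ : QVec n C}
    (h : constraintSum I C ψ = 0) {s : Finset (Fin n)} (hs : s ∈ Finset.powersetCard k C) :
    (extendOp s C (I.K s)).mulVec ψ = 0 := by
  have key : ∀ t ∈ Finset.powersetCard k C,
      star ψ ⬝ᵥ (extendOp t C (I.K t)).mulVec ψ =
        star ((extendOp t C (I.K t)).mulVec ψ) ⬝ᵥ (extendOp t C (I.K t)).mulVec ψ := by
    intro t ht
    obtain ⟨htC, htk⟩ := Finset.mem_powersetCard.mp ht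
    conv_lhs => rw [← extendOp_mulVec_mulVec htC (I.isIdempotent t htk)]
    rw [Matrix.dotProduct_mulVec, Matrix.star_mulVec,
      (extendOp_isHermitian t C (I.isHermitian t htk)).eq]
  have hsum : ∑ t ∈ Finset.powersetCard k C,
      star ((extendOp t C (I.K t)).mulVec ψ) ⬝ᵥ (extendOp t C (I.K t)).mulVec ψ = 0 := by
    rw [← Finset.sum_congr rfl key, ← dotProduct_sum]
    change star ψ ⬝ᵥ constraintSum I C ψ = 0
    rw [h, dotProduct_zero]
  exact dotProduct_star_self_eq_zero.mp
    ((Finset.sum_eq_zero_iff_of_nonneg fun t _ => dotProduct_star_self_nonneg _).mp hsum s hs)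

/-- The support of the reduced state on `C` of a solution solves the restricted instance. -/
lemma constraintSum_eq_zero_of_mem_reducedSupp {n k : ℕ} (I : Instance n k)
    {ψ : QVec n Finset.univ} (h : constraintSum I Finset.univ ψ = 0) (C : Finset (Fin n))
    {w : QVec n C} (hw : w ∈ reducedSupp C fun f => ψ fun i => f i) :
    constraintSum I C w = 0 := by
  refine Finset.sum_eq_zero fun s hs => ?_
  obtain ⟨hsC, hsk⟩ := Finset.mem_powersetCard.mp hs
  have hψ := extendOp_mulVec_eq_zero I h
    (Finset.mem_powersetCard.mpr ⟨Finset.subset_univ s, hsk⟩)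
  suffices reducedSupp C (fun f => ψ fun i => f i) ≤
      LinearMap.ker (extendOp s C (I.K s)).mulVecLin from this hw
  refine Submodule.span_le.mpr ?_
  rintro _ ⟨g, rfl⟩
  change (extendOp s C (I.K s)).mulVec _ = 0
  funext f
  have hf := congrFun hψ fun i => merge C f g i
  rw [extendOp_mulVec_apply (Finset.subset_univ s)] at hf
  rw [extendOp_mulVec_apply hsC]
  refine Eq.trans (Finset.sum_congr rfl fun a _ => ?_) hf
  congr 1
  · congr 1
    funext j
    simp [merge, hsC j.2]
  · refine congrArg ψ ?_
    funext i
    by_cases hi : (i : Fin n) ∈ s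
    · simp [merge, override, hi, hsC hi]
    · by_cases hiC : (i : Fin n) ∈ C <;> simp [merge, override, hi, hiC]

lemma prodSatisfiableAt_of_containsProdVec {n k : ℕ} (I : Instance n k)
    {ψ : QVec n Finset.univ} (h : constraintSum I Finset.univ ψ = 0) {C : Finset (Fin n)}
    (hC : ContainsProdVec C (reducedSupp C fun f => ψ fun i => f i)) :
    ProdSatisfiableAt I C := by
  obtain ⟨φ, hφ, hmem⟩ := hC
  exact ⟨φ, hφ, constraintSum_eq_zero_of_mem_reducedSupp I h C hmem⟩

/-- The contraction of `ψ` onto the qubits `a`, `b` against the bits of `h` elsewhere. -/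
def slice {n : ℕ} (ψ : (Fin n → Fin 2) → ℂ) (a b : Fin n) (h : Fin n → Fin 2) :
    Fin 2 → Fin 2 → ℂ :=
  fun i j => ψ (Function.update (Function.update h a i) b j)

/-- View a two-qubit vector as a vector on the qubits in `{a, b}`. -/
def pairMap {n : ℕ} (a b : Fin n) :
    (Fin 2 → Fin 2 → ℂ) →ₗ[ℂ] QVec n ({a, b} : Finset (Fin n)) where
  toFun M f := M (f ⟨a, by simp⟩) (f ⟨b, by simp⟩)
  map_add' _ _ := rfl
  map_smul' _ _ := rfl

lemma pairMap_slice_mem {n : ℕ} (ψ : (Fin n → Fin 2) → ℂ) (a b : Fin n) (h : Fin n → Fin 2) :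
    pairMap a b (slice ψ a b h) ∈ reducedSupp ({a, b} : Finset (Fin n)) ψ := by
  refine Submodule.subset_span ⟨fun i => h i, ?_⟩
  funext f
  change ψ _ = ψ _
  congr 1
  funext i
  by_cases hb : i = b
  · subst hb
    simp [merge]
  · by_cases ha : i = a
    · subst ha
      simp [merge, Function.update_of_ne hb]
    · simp [merge, ha, hb]

lemma containsProdVec_of_pairMap_mem {n : ℕ} {a b : Fin n} (hab : b ≠ a)
    {W : Submodule ℂ (QVec n ({a, b} : Finset (Fin n)))} {u v : Fin 2 → ℂ}
    (hne : (fun i j => u i * v j) ≠ (0 : Fin 2 → Fin 2 → ℂ))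
    (hW : pairMap a b (fun i j => u i * v j) ∈ W) : ContainsProdVec {a, b} W := by
  have hu : u ≠ 0 := by
    rintro rfl
    exact hne (by ext; simp)
  have hv : v ≠ 0 := by
    rintro rfl
    exact hne (by ext; simp)
  refine ⟨fun i => if (i : Fin n) = a then u else v, fun i => ?_, ?_⟩
  · dsimp only
    split_ifs <;> assumption
  · convert hW using 1
    funext f
    have huniv : (Finset.univ : Finset ↥({a, b} : Finset (Fin n))) =
        {⟨a, by simp⟩, ⟨b, by simp⟩} := by
      ext ⟨i, hi⟩
      simp [eq_comm]
    change ∏ i, _ = u _ * v _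
    rw [huniv, Finset.prod_pair (by simpa using hab.symm)]
    simp [hab]

lemma exists_eq_mul_of_det_eq_zero {M : Fin 2 → Fin 2 → ℂ}
    (h : M 0 0 * M 1 1 - M 0 1 * M 1 0 = 0) :
    ∃ u v : Fin 2 → ℂ, M = fun i j => u i * v j := by
  by_cases h0 : M 0 0 = 0
  · by_cases h1 : M 0 1 = 0
    · refine ⟨![0, 1], M 1, ?_⟩
      ext i j
      fin_cases i <;> fin_cases j <;> simp [h0, h1]
    · have h10 : M 1 0 = 0 := by
        simpa [h0, h1] using h
      refine ⟨![1, M 1 1 / M 0 1], M 0, ?_⟩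
      ext i j
      fin_cases i <;> fin_cases j <;> simp [h0, h1, h10]
  · refine ⟨![1, M 1 0 / M 0 0], M 0, ?_⟩
    ext i j
    fin_cases i <;> fin_cases j <;> simp [h0]
    field_simp
    linear_combination h

/-- Two vectors of a subspace of `ℂ² ⊗ ℂ²` without nonzero product vectors are proportional. -/
lemma exists_smul_eq_of_no_product {S : Submodule ℂ (Fin 2 → Fin 2 → ℂ)}
    (hS : ∀ u v : Fin 2 → ℂ, (fun i j => u i * v j) ∈ S →
      (fun i j => u i * v j) = (0 : Fin 2 → Fin 2 → ℂ))
    {M N : Fin 2 → Fin 2 → ℂ} (hM : M ∈ S) (hN : N ∈ S) (hM0 : M ≠ 0) : ∃ t : ℂ, N = t • M := by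
  have hdet : M 0 0 * M 1 1 - M 0 1 * M 1 0 ≠ 0 := by
    intro h
    obtain ⟨u, v, rfl⟩ := exists_eq_mul_of_det_eq_zero h
    exact hM0 (hS u v hM)
  obtain ⟨t, ht⟩ := exists_quadratic_eq_zero
    (b := -(N 0 0 * M 1 1 + M 0 0 * N 1 1 - N 0 1 * M 1 0 - M 0 1 * N 1 0))
    (c := N 0 0 * N 1 1 - N 0 1 * N 1 0) hdet
    (IsAlgClosed.exists_eq_mul_self _)
  refine ⟨t, sub_eq_zero.mp ?_⟩
  have hmem : N - t • M ∈ S := S.sub_mem hN (S.smul_mem t hM)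
  obtain ⟨u, v, huv⟩ := exists_eq_mul_of_det_eq_zero (M := N - t • M) (by
    simp only [Pi.sub_apply, Pi.smul_apply, smul_eq_mul]
    linear_combination ht)
  rw [huv] at hmem ⊢
  exact hS u v hmem

/-- If the reduced support on `{a, b}` has no nonzero product vector, then `{a, b}` is in a pure
state, so the reduced support on `{a, c}` does contain a nonzero product vector. -/
lemma containsProdVec_of_not_containsProdVec {n : ℕ} {ψ : (Fin n → Fin 2) → ℂ} (hψ : ψ ≠ 0)
    {a b c : Fin n} (hba : b ≠ a) (hca : c ≠ a) (hbc : b ≠ c)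
    (hab : ¬ ContainsProdVec ({a, b} : Finset (Fin n))
      (reducedSupp ({a, b} : Finset (Fin n)) ψ)) :
    ContainsProdVec ({a, c} : Finset (Fin n)) (reducedSupp ({a, c} : Finset (Fin n)) ψ) := by
  obtain ⟨h, hh⟩ := Function.ne_iff.mp hψ
  have slice_self : ∀ b, slice ψ a b h (h a) (h b) = ψ h := by simp [slice]
  have slice_ne : ∀ b, slice ψ a b h ≠ 0 := by
    intro b h0
    apply hh
    rw [← slice_self b, h0]
    rfl
  have hprop : ∀ g, ∃ t : ℂ, slice ψ a b g = t • slice ψ a b h := fun g =>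
    exists_smul_eq_of_no_product
      (S := (reducedSupp ({a, b} : Finset (Fin n)) ψ).comap (pairMap a b))
      (fun u v huv => by
        by_contra hne
        exact hab (containsProdVec_of_pairMap_mem hba hne huv))
      (pairMap_slice_mem ψ a b h) (pairMap_slice_mem ψ a b g) (slice_ne b)
  choose t ht using hprop
  have hfac : slice ψ a c h =
      fun i j => slice ψ a b h i (h b) * t (Function.update h c j) := by
    funext i j
    have hj := congrFun (congrFun (ht (Function.update h c j)) i) (h b)
    simp only [Pi.smul_apply, smul_eq_mul] at hj
    rw [mul_comm, ← hj]
    unfold slice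
    congr 1
    funext m
    by_cases hma : m = a
    · subst hma
      simp [Function.update_of_ne hba.symm, Function.update_of_ne hca.symm]
    · by_cases hmb : m = b
      · subst hmb
        simp [hma, hbc]
      · by_cases hmc : m = c
        · subst hmc
          simp [hma, hmb]
        · simp [hma, hmb, hmc]
  refine containsProdVec_of_pairMap_mem hca (hfac ▸ slice_ne c) ?_
  rw [← hfac]
  exact pairMap_slice_mem ψ a c h

/-- **Proposition (the case `c = 2`).**
For a satisfiable instance of quantum `k`-SAT and any qubit `x₁`, there is at most one
qubit `x₂ ≠ x₁` such that the instance is not locally satisfiable by a product state at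
`{x₁,x₂}`.  Equivalently, for any nonzero state `|ψ⟩ ∈ (ℂ²)^{⊗n}` and any qubit `x₁`,
there is at most one qubit `x₂ ≠ x₁` such that the support of the reduced density matrix
of `|ψ⟩` on `{x₁,x₂}` contains no nonzero product vector. -/
theorem at_most_one_nonproduct_partner (n k : ℕ) :
    (∀ I : Instance n k, Satisfiable I → ∀ x₁ x₂ x₂' : Fin n,
      x₂ ≠ x₁ → x₂' ≠ x₁ →
      ¬ ProdSatisfiableAt I ({x₁, x₂} : Finset (Fin n)) →
      ¬ ProdSatisfiableAt I ({x₁, x₂'} : Finset (Fin n)) → x₂ = x₂') ∧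
    (∀ ψ : (Fin n → Fin 2) → ℂ, ψ ≠ 0 → ∀ x₁ x₂ x₂' : Fin n,
      x₂ ≠ x₁ → x₂' ≠ x₁ →
      ¬ ContainsProdVec ({x₁, x₂} : Finset (Fin n))
          (reducedSupp ({x₁, x₂} : Finset (Fin n)) ψ) →
      ¬ ContainsProdVec ({x₁, x₂'} : Finset (Fin n))
          (reducedSupp ({x₁, x₂'} : Finset (Fin n)) ψ) → x₂ = x₂') := by
  have pure_state : ∀ ψ : (Fin n → Fin 2) → ℂ, ψ ≠ 0 → ∀ x₁ x₂ x₂' : Fin n,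
      x₂ ≠ x₁ → x₂' ≠ x₁ →
      ¬ ContainsProdVec ({x₁, x₂} : Finset (Fin n))
          (reducedSupp ({x₁, x₂} : Finset (Fin n)) ψ) →
      ¬ ContainsProdVec ({x₁, x₂'} : Finset (Fin n))
          (reducedSupp ({x₁, x₂'} : Finset (Fin n)) ψ) → x₂ = x₂' := by
    intro ψ hψ x₁ x₂ x₂' h2 h2' hc hc'
    by_contra hne
    exact hc' (containsProdVec_of_not_containsProdVec hψ h2 h2' hne hc)
  refine ⟨?_, pure_state⟩
  rintro I ⟨ψ, hψ, hsat⟩ x₁ x₂ x₂' h2 h2' hc hc'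
  refine pure_state (fun f => ψ fun i => f i) (fun h0 => hψ ?_) x₁ x₂ x₂' h2 h2'
    (fun h => hc (prodSatisfiableAt_of_containsProdVec I hsat h))
    (fun h => hc' (prodSatisfiableAt_of_containsProdVec I hsat h))
  funext f
  exact congrFun h0 fun i => f ⟨i, Finset.mem_univ i⟩

end QkSAT
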